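/- Consider Ṙ(t) = κR(t)·(f(y(t)))⁺_{R(t)} with y(t) = Σ_{r∈S} R(t−τ_r), where f is strictly decreasing, continuously differentiable, f(ȳ) = 0 for some ȳ > 0. Let N = |S|, T̄ the mean delay, w = κT̄f(0)ȳ/(1−κT̄f(0)), f⁽¹⁾ = max_{u∈(0,ȳ]} f(ȳ−u)/u, f⁽²⁾ = max_{u∈(0,w]} −f(ȳ+u)/u. If κT̄f(0) < 1 and κ²T̄²ȳ(ȳ+w)f⁽¹⁾f⁽²⁾/(1−κT̄f(0)) < 1, then y(t) → ȳ as t → ∞ for any positive bounded initial conditions. -/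

import Mathlib

open Set Filter

/-- The projection `(v)⁺_w`: equals `0` if `v < 0` and `w ≤ 0`, else `v`. -/
noncomputable def proj (v w : ℝ) : ℝ := if v < 0 ∧ w ≤ 0 then 0 else v

/-- A solution that decreases at a definite rate while above a level ends up below that level. -/
lemma eventually_le_of_deriv_le_neg {z z' : ℝ → ℝ} {T L d : ℝ} (hd : 0 < d)
    (hz : ∀ t > T, HasDerivAt z (z' t) t) (h : ∀ t > T, L ≤ z t → z' t ≤ -d) :
    ∀ᶠ t in atTop, z t ≤ L := by
  have hcross : ∃ t₁ > T, z t₁ ≤ L := by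
    by_contra! hne
    have hT : T < T + 1 := by linarith
    have hLz := hne (T + 1) hT
    set s := (z (T + 1) - L) / d + (T + 1) with hs
    have hsT : T + 1 ≤ s := by
      have : 0 ≤ (z (T + 1) - L) / d := div_nonneg (by linarith) hd.le
      linarith
    have key : z s - z (T + 1) ≤ (-d) * (s - (T + 1)) := by
      refine Convex.image_sub_le_mul_sub_of_deriv_le (convex_Ici (T + 1)) ?_ ?_ ?_
        (T + 1) self_mem_Ici s hsT hsT
      · intro t ht
        exact (hz t (hT.trans_le ht)).continuousAt.continuousWithinAt
      · intro t ht
        rw [interior_Ici] at ht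
        exact (hz t (hT.trans ht)).differentiableAt.differentiableWithinAt
      · intro t ht
        rw [interior_Ici] at ht
        rw [(hz t (hT.trans ht)).deriv]
        exact h t (hT.trans ht) (hne t (hT.trans ht)).le
    have h2 : d * (s - (T + 1)) = z (T + 1) - L := by
      rw [hs]; field_simp; ring
    have := hne s (hT.trans_le hsT)
    linarith
  obtain ⟨t₁, ht₁, hzt₁⟩ := hcross
  filter_upwards [eventually_ge_atTop t₁] with t ht
  refine image_le_of_deriv_right_lt_deriv_boundary (f := z) (f' := z') (a := t₁) (b := t)
    (B := fun _ => L) (B' := fun _ => 0) ?_ ?_ hzt₁ (fun x => hasDerivAt_const x L) ?_ ⟨ht, le_rfl⟩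
  · intro s hs
    exact (hz s (ht₁.trans_le hs.1)).continuousAt.continuousWithinAt
  · intro s hs
    exact (hz s (ht₁.trans_le hs.1)).hasDerivWithinAt
  · intro s hs hsL
    have := h s (ht₁.trans_le hs.1) hsL.ge
    linarith

lemma le_apply_zero_of_forall_pos_le {g : ℝ → ℝ} {c : ℝ} (hg : Continuous g)
    (h : ∀ ε > 0, c ≤ g ε) : c ≤ g 0 := by
  refine ge_of_tendsto ((hg.tendsto 0).mono_left (nhdsWithin_le_nhds (s := Ioi 0))) ?_
  filter_upwards [self_mem_nhdsWithin] with ε hε using h ε hε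

/-- The derivative at the right end of an interval on which the function is bounded by its
right end value is nonnegative. -/
lemma HasDerivAt.nonneg_of_forall_le_left {g : ℝ → ℝ} {d a t : ℝ} (hat : a < t)
    (hg : HasDerivAt g d t) (hmax : ∀ s ∈ Ioo a t, g s ≤ g t) : 0 ≤ d := by
  have hs : Tendsto (slope g t) (nhdsWithin t (Iio t)) (nhds d) :=
    hg.tendsto_slope.mono_left (nhdsWithin_mono _ fun x hx => ne_of_lt hx)
  refine ge_of_tendsto hs ?_
  filter_upwards [Ioo_mem_nhdsLT hat] with s hs
  rw [slope_def_field]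
  exact div_nonneg_of_nonpos (by linarith [hmax s hs]) (by linarith [hs.2])

/-- A positive solution of `R' = κ R f(y)`, `y t = ∑ R (t - τ r)`, with delays in `[0, τmax]`. -/
structure IsPositiveDelaySolution {ι : Type*} (S : Finset ι) (τ : ι → ℝ) (τmax κ : ℝ)
    (f R y : ℝ → ℝ) : Prop where
  delay_nonneg : ∀ r ∈ S, 0 ≤ τ r
  delay_le : ∀ r ∈ S, τ r ≤ τmax
  max_nonneg : 0 ≤ τmax
  gain_pos : 0 < κ
  total : ∀ t, y t = ∑ r ∈ S, R (t - τ r)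
  pos : ∀ t ≥ -τmax, 0 < R t
  deriv : ∀ t > 0, HasDerivAt R (κ * R t * f (y t)) t

lemma mul_sub_sum_delay_le {ι : Type*} {S : Finset ι} {τ : ι → ℝ} {τmax C t : ℝ} {R R' : ℝ → ℝ}
    (hτ : ∀ r ∈ S, 0 ≤ τ r) (hle : ∀ r ∈ S, τ r ≤ τmax)
    (hR : ∀ s ∈ Icc (t - τmax) t, HasDerivAt R (R' s) s)
    (hC : ∀ s ∈ Icc (t - τmax) t, R' s ≤ C) :
    S.card * R t - ∑ r ∈ S, R (t - τ r) ≤ C * ∑ r ∈ S, τ r := by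
  have h : ∀ r ∈ S, R t - R (t - τ r) ≤ C * τ r := by
    intro r hr
    have h0 := hτ r hr
    have h1 := hle r hr
    have := Convex.image_sub_le_mul_sub_of_deriv_le (convex_Icc (t - τmax) t)
      (fun s hs => (hR s hs).continuousAt.continuousWithinAt)
      (fun s hs => (hR s (interior_subset hs)).differentiableAt.differentiableWithinAt)
      (C := C) (fun s hs => by
        rw [(hR s (interior_subset hs)).deriv]; exact hC s (interior_subset hs))
      (t - τ r) ⟨by linarith, by linarith⟩ t ⟨by linarith, le_rfl⟩ (by linarith)
    simpa using this
  have := Finset.sum_le_sum h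
  rw [Finset.sum_sub_distrib, Finset.sum_const, nsmul_eq_mul, ← Finset.mul_sum] at this
  exact this

namespace IsPositiveDelaySolution

variable {ι : Type*} {S : Finset ι} {τ : ι → ℝ} {τmax κ ybar : ℝ} {f R y : ℝ → ℝ}

lemma total_nonneg (h : IsPositiveDelaySolution S τ τmax κ f R y) {t : ℝ} (ht : 0 ≤ t) :
    0 ≤ y t := by
  rw [h.total]
  exact Finset.sum_nonneg fun r hr => (h.pos _ (by linarith [h.delay_le r hr])).le

lemma hasDerivAt_log (h : IsPositiveDelaySolution S τ τmax κ f R y) {t : ℝ} (ht : 0 < t) :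
    HasDerivAt (fun s => Real.log (R s)) (κ * f (y t)) t := by
  have hp : 0 < R t := h.pos t (by linarith [h.max_nonneg])
  convert (h.deriv t ht).log hp.ne' using 1
  field_simp

/-- If eventually `N R ≤ M` and `f(y) ≤ F`, then eventually `N R ≤ ȳ + κ T̄ M F + ε`. -/
lemma eventually_card_mul_le (h : IsPositiveDelaySolution S τ τmax κ f R y) (hS : S.Nonempty)
    (hanti : StrictAntiOn f (Ici 0)) (hybar : 0 < ybar) (hfzero : f ybar = 0)
    {M F ε : ℝ} (hM : 0 ≤ M) (hF : 0 ≤ F) (hε : 0 < ε)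
    (hRM : ∀ᶠ t in atTop, S.card * R t ≤ M) (hfF : ∀ᶠ t in atTop, f (y t) ≤ F) :
    ∀ᶠ t in atTop, S.card * R t ≤ ybar + κ * ((∑ r ∈ S, τ r) / S.card) * M * F + ε := by
  have hN : (0 : ℝ) < S.card := by exact_mod_cast hS.card_pos
  have hκ := h.gain_pos
  set K := κ * ((∑ r ∈ S, τ r) / S.card) * M * F with hK
  have hK0 : 0 ≤ K := by
    have : 0 ≤ ∑ r ∈ S, τ r := Finset.sum_nonneg h.delay_nonneg
    positivity
  obtain ⟨T, hT⟩ := eventually_atTop.1 (hRM.and hfF)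
  have hneg : f (ybar + ε) < 0 := by
    rw [← hfzero]; exact hanti hybar.le (by simp; linarith) (by linarith)
  have hL : 0 < (ybar + K + ε) / S.card := by positivity
  have key := eventually_le_of_deriv_le_neg (T := max T 0 + τmax)
    (L := Real.log ((ybar + K + ε) / S.card))
    (d := -(κ * f (ybar + ε))) (by nlinarith) (fun t ht => h.hasDerivAt_log (t := t) (by
      have := le_max_right T 0; have := h.max_nonneg; linarith)) (by
    intro t ht hLt
    have hT0 := le_max_right T 0
    have hTT := le_max_left T 0
    have hm := h.max_nonneg
    have ht0 : 0 < t := by linarith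
    have hRt := h.pos t (by linarith)
    rw [Real.log_le_log_iff hL hRt, div_le_iff₀ hN] at hLt
    have hd := mul_sub_sum_delay_le (t := t) (C := κ * (M / S.card) * F) h.delay_nonneg h.delay_le
      (fun s hs => h.deriv s (by linarith [hs.1])) (by
        intro s hs
        obtain ⟨h1, h2⟩ := hT s (by linarith [hs.1])
        have hRs := h.pos s (by linarith [hs.1])
        have h3 : R s ≤ M / S.card := by rw [le_div_iff₀ hN]; linarith
        have h4 : κ * R s * f (y s) ≤ κ * R s * F := by gcongr
        have h5 : κ * R s * F ≤ κ * (M / S.card) * F := by gcongr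
        exact h4.trans h5)
    rw [← h.total] at hd
    have hKe : κ * (M / S.card) * F * ∑ r ∈ S, τ r = K := by rw [hK]; ring
    have hyt : ybar + ε ≤ y t := by linarith
    have : f (y t) ≤ f (ybar + ε) :=
      hanti.antitoneOn (by simp; linarith) (h.total_nonneg ht0.le) hyt
    have := mul_le_mul_of_nonneg_left this hκ.le
    linarith)
  filter_upwards [key, eventually_ge_atTop 0] with t ht ht0
  have hRt := h.pos t (by linarith [h.max_nonneg])
  rw [Real.log_le_log_iff hRt hL, le_div_iff₀ hN] at ht
  linarith

/-- If eventually `N R ≤ M` and `-f(y) ≤ G`, then eventually `ȳ - κ T̄ M G - ε ≤ N R`. -/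
lemma eventually_le_card_mul (h : IsPositiveDelaySolution S τ τmax κ f R y) (hS : S.Nonempty)
    (hanti : StrictAntiOn f (Ici 0)) (hybar : 0 < ybar) (hfzero : f ybar = 0)
    {M G ε : ℝ} (hG : 0 ≤ G) (hε : 0 < ε)
    (hRM : ∀ᶠ t in atTop, S.card * R t ≤ M) (hfG : ∀ᶠ t in atTop, -f (y t) ≤ G) :
    ∀ᶠ t in atTop, ybar - κ * ((∑ r ∈ S, τ r) / S.card) * M * G - ε ≤ S.card * R t := by
  have hN : (0 : ℝ) < S.card := by exact_mod_cast hS.card_pos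
  have hκ := h.gain_pos
  set K := κ * ((∑ r ∈ S, τ r) / S.card) * M * G with hK
  rcases le_or_gt (ybar - K - ε) 0 with hneg | hpos
  · filter_upwards [eventually_ge_atTop 0] with t ht
    have := h.pos t (by linarith [h.max_nonneg])
    nlinarith
  obtain ⟨T, hT⟩ := eventually_atTop.1 (hRM.and hfG)
  have hfpos : 0 < f (max (ybar - ε) 0) :=
    hfzero.symm.trans_lt (hanti (by simp) hybar.le (max_lt (by linarith) hybar))
  have hL : 0 < (ybar - K - ε) / S.card := by positivity
  have key := eventually_le_of_deriv_le_neg (T := max T 0 + τmax)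
    (L := -Real.log ((ybar - K - ε) / S.card))
    (d := κ * f (max (ybar - ε) 0)) (by positivity)
    (fun t ht => (h.hasDerivAt_log (t := t) (by
      have := le_max_right T 0; have := h.max_nonneg; linarith)).neg) (by
    intro t ht hLt
    have hT0 := le_max_right T 0
    have hTT := le_max_left T 0
    have hm := h.max_nonneg
    have ht0 : 0 < t := by linarith
    have hRt := h.pos t (by linarith)
    simp only [Pi.neg_apply] at hLt
    rw [neg_le_neg_iff, Real.log_le_log_iff hRt hL, le_div_iff₀ hN] at hLt
    have hd := mul_sub_sum_delay_le (t := t) (R := fun s => -R s)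
      (C := κ * (M / S.card) * G) h.delay_nonneg h.delay_le
      (fun s hs => (h.deriv s (by linarith [hs.1])).neg) (by
        intro s hs
        obtain ⟨h1, h2⟩ := hT s (by linarith [hs.1])
        have hRs := h.pos s (by linarith [hs.1])
        have h3 : R s ≤ M / S.card := by rw [le_div_iff₀ hN]; linarith
        have h4 : κ * R s * (-f (y s)) ≤ κ * R s * G := by gcongr
        have h5 : κ * R s * G ≤ κ * (M / S.card) * G := by gcongr
        linarith)
    rw [Finset.sum_neg_distrib, ← h.total] at hd
    have hKe : κ * (M / S.card) * G * ∑ r ∈ S, τ r = K := by rw [hK]; ring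
    have hyt : y t ≤ ybar - ε := by linarith
    have : f (max (ybar - ε) 0) ≤ f (y t) :=
      hanti.antitoneOn (h.total_nonneg ht0.le) (by simp) (hyt.trans (le_max_left _ _))
    have := mul_le_mul_of_nonneg_left this hκ.le
    linarith)
  filter_upwards [key, eventually_ge_atTop 0] with t ht ht0
  have hRt := h.pos t (by linarith [h.max_nonneg])
  simp only [Pi.neg_apply] at ht
  rw [neg_le_neg_iff, Real.log_le_log_iff hL hRt, div_le_iff₀ hN] at ht
  linarith

lemma exists_forall_le (h : IsPositiveDelaySolution S τ τmax κ f R y) (hS : S.Nonempty)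
    (hanti : StrictAntiOn f (Ici 0)) (hybar : 0 < ybar) (hfzero : f ybar = 0)
    (hRcont : Continuous R) (hsmall : κ * ((∑ r ∈ S, τ r) / S.card) * f 0 < 1) :
    ∃ B, ∀ t ≥ 0, R t ≤ B := by
  have hN : (0 : ℝ) < S.card := by exact_mod_cast hS.card_pos
  have hκ := h.gain_pos
  have hm := h.max_nonneg
  set q := κ * ((∑ r ∈ S, τ r) / S.card) * f 0 with hq
  have hf0 : 0 < f 0 := hfzero.symm.trans_lt (hanti (by simp) hybar.le hybar)
  obtain ⟨B₀, hB₀⟩ := (isCompact_Icc (a := (0 : ℝ)) (b := τmax)).bddAbove_image hRcont.continuousOn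
  refine ⟨max B₀ (ybar / (S.card * (1 - q))), fun t₁ ht₁ => ?_⟩
  obtain ⟨t, ht, hmax⟩ := (isCompact_Icc (a := (0 : ℝ)) (b := t₁)).exists_isMaxOn
    ⟨0, le_rfl, ht₁⟩ hRcont.continuousOn
  refine (hmax ⟨ht₁, le_rfl⟩ : R t₁ ≤ R t).trans ?_
  rcases le_or_gt t τmax with hle | hgt
  · exact (hB₀ ⟨t, ⟨ht.1, hle⟩, rfl⟩).trans (le_max_left _ _)
  refine le_trans ?_ (le_max_right _ _)
  by_contra! hbig
  have ht0 : 0 < t := by linarith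
  rw [div_lt_iff₀ (by nlinarith)] at hbig
  have hRt := h.pos t (by linarith)
  have hd := mul_sub_sum_delay_le (t := t) (C := κ * R t * f 0) h.delay_nonneg h.delay_le
    (fun s hs => h.deriv s (by linarith [hs.1])) (by
      intro s hs
      have hs0 : 0 ≤ s := by linarith [hs.1]
      have hRs := h.pos s (by linarith)
      have h1 : R s ≤ R t := hmax ⟨hs0, hs.2.trans ht.2⟩
      have h2 : f (y s) ≤ f 0 :=
        hanti.antitoneOn (by simp) (h.total_nonneg hs0) (h.total_nonneg hs0)
      have h4 : κ * R s * f (y s) ≤ κ * R s * f 0 := by gcongr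
      have h5 : κ * R s * f 0 ≤ κ * R t * f 0 := by gcongr
      exact h4.trans h5)
  rw [← h.total] at hd
  have hKe : κ * R t * f 0 * ∑ r ∈ S, τ r = S.card * R t * q := by rw [hq]; field_simp
  have hyt : ybar < y t := by linarith
  have hneg : f (y t) < 0 := by
    rw [← hfzero]; exact hanti hybar.le (h.total_nonneg ht0.le) hyt
  have := (h.deriv t ht0).nonneg_of_forall_le_left ht0
    (fun s hs => hmax ⟨hs.1.le, hs.2.le.trans ht.2⟩)
  have : κ * R t * f (y t) < 0 := mul_neg_of_pos_of_neg (by positivity) hneg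
  linarith

lemma eventually_total_le (h : IsPositiveDelaySolution S τ τmax κ f R y) (hS : S.Nonempty)
    {M : ℝ} (hRM : ∀ᶠ t in atTop, S.card * R t ≤ M) : ∀ᶠ t in atTop, y t ≤ M := by
  have hN : (0 : ℝ) < S.card := by exact_mod_cast hS.card_pos
  obtain ⟨T, hT⟩ := eventually_atTop.1 hRM
  filter_upwards [eventually_ge_atTop (T + τmax)] with t ht
  rw [h.total]
  have : ∑ r ∈ S, R (t - τ r) ≤ ∑ _r ∈ S, M / S.card := Finset.sum_le_sum fun r hr => by
    rw [le_div_iff₀ hN, mul_comm]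
    exact hT _ (by linarith [h.delay_le r hr])
  rw [Finset.sum_const, nsmul_eq_mul, mul_div_cancel₀ _ hN.ne'] at this
  exact this

lemma eventually_le_total (h : IsPositiveDelaySolution S τ τmax κ f R y) (hS : S.Nonempty)
    {m : ℝ} (hRm : ∀ᶠ t in atTop, m ≤ S.card * R t) : ∀ᶠ t in atTop, m ≤ y t := by
  have hN : (0 : ℝ) < S.card := by exact_mod_cast hS.card_pos
  obtain ⟨T, hT⟩ := eventually_atTop.1 hRm
  filter_upwards [eventually_ge_atTop (T + τmax)] with t ht
  rw [h.total]
  have : ∑ _r ∈ S, m / S.card ≤ ∑ r ∈ S, R (t - τ r) := Finset.sum_le_sum fun r hr => by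
    rw [div_le_iff₀ hN, mul_comm]
    exact hT _ (by linarith [h.delay_le r hr])
  rw [Finset.sum_const, nsmul_eq_mul, mul_div_cancel₀ _ hN.ne'] at this
  exact this

end IsPositiveDelaySolution

/-- Solutions of the projected delay equation with positive initial data stay positive. -/
lemma pos_of_projected_delay {ι : Type*} {S : Finset ι} {τ : ι → ℝ} {τmax κ : ℝ} {f R y : ℝ → ℝ}
    (hτ : ∀ r ∈ S, 0 ≤ τ r) (hle : ∀ r ∈ S, τ r ≤ τmax) (hm : 0 ≤ τmax) (hκ : 0 < κ)
    (hf : ContinuousOn f (Ici 0)) (hy : ∀ t, y t = ∑ r ∈ S, R (t - τ r)) (hRcont : Continuous R)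
    (hRpos : ∀ t ∈ Icc (-τmax) 0, 0 < R t)
    (hode : ∀ t > 0, HasDerivAt R (κ * R t * proj (f (y t)) (R t)) t) :
    ∀ t ≥ -τmax, 0 < R t := by
  by_contra! hne
  obtain ⟨t₁, ht₁, hRt₁⟩ := hne
  have hcl : IsClosed {t | 0 ≤ t ∧ R t ≤ 0} :=
    (isClosed_Ici (a := (0 : ℝ))).inter (isClosed_le hRcont continuous_const)
  have hnon : {t | 0 ≤ t ∧ R t ≤ 0}.Nonempty := by
    refine ⟨t₁, ?_, hRt₁⟩
    by_contra! hlt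
    linarith [hRpos t₁ ⟨ht₁, hlt.le⟩]
  have hbdd : BddBelow {t | 0 ≤ t ∧ R t ≤ 0} := ⟨0, fun t ht => ht.1⟩
  obtain ⟨hs0, hRs⟩ := hcl.csInf_mem hnon hbdd
  have hbefore : ∀ t < sInf {t | 0 ≤ t ∧ R t ≤ 0}, -τmax ≤ t → 0 < R t := by
    intro t ht htm
    rcases le_or_gt t 0 with h0 | h0
    · exact hRpos t ⟨htm, h0⟩
    · by_contra! hR
      exact notMem_of_lt_csInf ht hbdd ⟨h0.le, hR⟩
  set s := sInf {t | 0 ≤ t ∧ R t ≤ 0}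
  have hR0 : 0 < R 0 := hRpos 0 ⟨by linarith, le_rfl⟩
  have hspos : 0 < s := lt_of_le_of_ne hs0 (by rintro h0; rw [← h0] at hRs; linarith)
  have hnn : ∀ t ∈ Icc (-τmax) s, 0 ≤ R t := by
    have : closure (Ico (-τmax) s) ⊆ {t | 0 ≤ R t} :=
      closure_minimal (fun t ht => (hbefore t ht.2 ht.1).le) (isClosed_le continuous_const hRcont)
    rwa [closure_Ico (by linarith)] at this
  have hynn : ∀ t ∈ Icc 0 s, 0 ≤ y t := by
    intro t ht
    rw [hy]
    refine Finset.sum_nonneg fun r hr => hnn _ ⟨?_, ?_⟩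
    · linarith [hle r hr, ht.1]
    · linarith [hτ r hr, ht.2]
  have hycont : Continuous y := by
    rw [funext hy]
    fun_prop
  obtain ⟨c, hc⟩ := (isCompact_Icc (a := (0 : ℝ)) (b := s)).bddBelow_image
    (hf.comp hycont.continuousOn hynn)
  have hmono : MonotoneOn (fun t => R t * Real.exp (-(κ * c) * t)) (Icc 0 s) := by
    refine monotoneOn_of_deriv_nonneg (convex_Icc 0 s) (by fun_prop) ?_ ?_
    · intro t ht
      rw [interior_Icc] at ht
      have := (hode t ht.1).differentiableAt
      exact DifferentiableAt.differentiableWithinAt (by fun_prop)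
    · intro t ht
      rw [interior_Icc] at ht
      have hRt := hbefore t ht.2 (by linarith [ht.1])
      have hd := hode t ht.1
      rw [proj, if_neg (by simp [hRt])] at hd
      have he : HasDerivAt (fun t => Real.exp (-(κ * c) * t))
          (Real.exp (-(κ * c) * t) * (-(κ * c))) t := by
        simpa using ((hasDerivAt_id t).const_mul (-(κ * c))).exp
      have hprod := (hd.mul he).deriv
      have hct : c ≤ f (y t) := hc ⟨t, ⟨ht.1.le, ht.2.le⟩, rfl⟩
      change 0 ≤ deriv (R * fun t => Real.exp (-(κ * c) * t)) t
      rw [hprod]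
      have : 0 ≤ κ * R t * Real.exp (-(κ * c) * t) * (f (y t) - c) :=
        mul_nonneg (by positivity) (by linarith)
      linarith
  have := hmono ⟨le_rfl, hs0⟩ ⟨hs0, le_rfl⟩ hs0
  simp only [mul_zero, Real.exp_zero, mul_one] at this
  nlinarith [Real.exp_pos (-(κ * c) * s)]

theorem stmt_10 {ι : Type*} (S : Finset ι) (hS : S.Nonempty)
    (τ : ι → ℝ) (hτ : ∀ r ∈ S, 0 ≤ τ r)
    (N : ℕ) (hN : N = S.card)
    (Tbar τmax : ℝ) (hTbar : Tbar = (∑ r ∈ S, τ r) / N)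
    (hτmax : IsGreatest (τ '' S) τmax)
    (κ : ℝ) (hκ : 0 < κ)
    (f : ℝ → ℝ) (hanti : StrictAntiOn f (Ici 0)) (hC1 : ContDiffOn ℝ 1 f (Ici 0))
    (ybar : ℝ) (hybar : 0 < ybar) (hfzero : f ybar = 0)
    (w f1 f2 : ℝ)
    (hw : w = κ * Tbar * f 0 * ybar / (1 - κ * Tbar * f 0))
    (hf1 : IsGreatest {x : ℝ | ∃ u ∈ Ioc (0:ℝ) ybar, x = f (ybar - u) / u} f1)
    (hf2 : IsGreatest {x : ℝ | ∃ u ∈ Ioc (0:ℝ) w, x = -f (ybar + u) / u} f2)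
    (hsmall : κ * Tbar * f 0 < 1)
    (hcond : κ^2 * Tbar^2 * ybar * (ybar + w) * f1 * f2 / (1 - κ * Tbar * f 0) < 1)
    (R y : ℝ → ℝ) (hy : ∀ t, y t = ∑ r ∈ S, R (t - τ r))
    (hRcont : Continuous R)
    (hRpos : ∀ t ∈ Icc (-τmax) 0, 0 < R t)
    (hRbdd : BddAbove (R '' Icc (-τmax) 0))
    (hode : ∀ t > 0, HasDerivAt R (κ * R t * proj (f (y t)) (R t)) t) :
    Tendsto y atTop (nhds ybar) := by
  subst hN
  have hdel : ∀ r ∈ S, τ r ≤ τmax := fun r hr => hτmax.2 ⟨r, hr, rfl⟩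
  have hm : 0 ≤ τmax := by
    obtain ⟨r, hr⟩ := hS
    exact (hτ r hr).trans (hdel r hr)
  have hpos := pos_of_projected_delay hτ hdel hm hκ hC1.continuousOn hy hRcont hRpos hode
  have h : IsPositiveDelaySolution S τ τmax κ f R y := by
    refine ⟨hτ, hdel, hm, hκ, hy, hpos, fun t ht => ?_⟩
    have hd := hode t ht
    rwa [proj, if_neg (by simp [hpos t (by linarith)])] at hd
  have hN : (0 : ℝ) < S.card := by exact_mod_cast hS.card_pos
  have hT0 : 0 ≤ Tbar := by
    rw [hTbar]; exact div_nonneg (Finset.sum_nonneg hτ) hN.le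
  have hf0 : 0 < f 0 := hfzero.symm.trans_lt (hanti (by simp) hybar.le hybar)
  set q := κ * Tbar * f 0 with hq
  have hq0 : 0 ≤ q := by positivity
  have hw0 : 0 ≤ w := by rw [hw]; exact div_nonneg (by positivity) (by linarith)
  have hyw : (ybar + w) * (1 - q) = ybar := by
    rw [hw]; field_simp [show 1 - q ≠ 0 by linarith]; ring
  -- sector bounds on `f`
  have hf1nn : 0 ≤ f1 := by
    obtain ⟨u, hu, rfl⟩ := hf1.1
    refine div_nonneg ?_ hu.1.le
    rw [← hfzero]
    exact hanti.antitoneOn (by simp [hu.2]) hybar.le (by linarith [hu.1])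
  have hf2nn : 0 ≤ f2 := by
    obtain ⟨u, hu, rfl⟩ := hf2.1
    refine div_nonneg ?_ hu.1.le
    have : f (ybar + u) ≤ f ybar :=
      hanti.antitoneOn hybar.le (by simp; linarith [hu.1]) (by linarith [hu.1])
    linarith
  have hlow : ∀ v ≥ 0, ∀ β ≥ 0, ybar - β ≤ v → f v ≤ f1 * β := by
    intro v hv β hβ hvβ
    rcases le_or_gt ybar v with hle | hlt
    · have : f v ≤ f ybar := hanti.antitoneOn hybar.le hv hle
      rw [hfzero] at this
      exact this.trans (by positivity)
    · have : f (ybar - (ybar - v)) / (ybar - v) ≤ f1 :=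
        hf1.2 ⟨ybar - v, ⟨by linarith, by linarith⟩, rfl⟩
      rw [sub_sub_cancel, div_le_iff₀ (by linarith)] at this
      exact this.trans (by gcongr; linarith)
  have hhigh : ∀ α ∈ Icc 0 w, -f (ybar + α) ≤ f2 * α := by
    rintro α ⟨hα, hαw⟩
    rcases hα.eq_or_lt with rfl | hα
    · simp [hfzero]
    · have : -f (ybar + α) / α ≤ f2 := hf2.2 ⟨α, ⟨hα, hαw⟩, rfl⟩
      rwa [div_le_iff₀ hα] at this
  -- asymptotic bounds of `N R`
  obtain ⟨B, hB⟩ := h.exists_forall_le hS hanti hybar hfzero hRcont (by rwa [← hTbar])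
  set x : ℝ → ℝ := fun t => S.card * R t with hx
  have hxpos : ∀ᶠ t in atTop, 0 ≤ x t := by
    filter_upwards [eventually_ge_atTop 0] with t ht
    exact mul_nonneg hN.le (hpos t (by linarith)).le
  have hxB : ∀ᶠ t in atTop, x t ≤ S.card * B := by
    filter_upwards [eventually_ge_atTop 0] with t ht
    exact mul_le_mul_of_nonneg_left (hB t ht) hN.le
  have hbA : IsBoundedUnder (· ≤ ·) atTop x := ⟨_, hxB⟩
  have hbm : IsBoundedUnder (· ≥ ·) atTop x := ⟨_, hxpos⟩
  set A := limsup x atTop with hA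
  set m := liminf x atTop with hmdef
  have hltA : ∀ ε > 0, ∀ᶠ t in atTop, x t ≤ A + ε := fun ε hε =>
    (eventually_lt_of_limsup_lt (by linarith : limsup x atTop < A + ε) hbA).mono fun t ht => ht.le
  have hgtm : ∀ ε > 0, ∀ᶠ t in atTop, m - ε ≤ x t := fun ε hε =>
    (eventually_lt_of_lt_liminf (by linarith : m - ε < liminf x atTop) hbm).mono fun t ht => ht.le
  have hAle : ∀ c, (∀ᶠ t in atTop, x t ≤ c) → A ≤ c := fun c hc =>
    limsup_le_of_le hbm.isCoboundedUnder_le hc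
  have hlem : ∀ c, (∀ᶠ t in atTop, c ≤ x t) → c ≤ m := fun c hc =>
    le_liminf_of_le hbA.isCoboundedUnder_ge hc
  have hm0 : 0 ≤ m := hlem 0 hxpos
  have hA0 : 0 ≤ A := hm0.trans (liminf_le_limsup hbA hbm)
  have hynn : ∀ᶠ t in atTop, 0 ≤ y t := by
    filter_upwards [eventually_ge_atTop 0] with t ht using h.total_nonneg ht
  have hAw : A ≤ ybar + w := by
    have : A ≤ ybar + κ * Tbar * (A + 0) * f 0 + 0 := by
      refine le_apply_zero_of_forall_pos_le (g := fun ε => ybar + κ * Tbar * (A + ε) * f 0 + ε)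
        (by fun_prop) fun ε hε => hAle _ ?_
      rw [hTbar]
      refine h.eventually_card_mul_le hS hanti hybar hfzero (by linarith) hf0.le hε (hltA ε hε) ?_
      filter_upwards [hynn] with t ht using hanti.antitoneOn (by simp) ht ht
    have h2 : A * (1 - q) ≤ (ybar + w) * (1 - q) := by rw [hyw, hq]; linarith
    exact le_of_mul_le_mul_right h2 (by linarith)
  set a := max (A - ybar) 0 with ha
  set b := max (ybar - m) 0 with hb
  have ha0 : 0 ≤ a := le_max_right _ _
  have hb0 : 0 ≤ b := le_max_right _ _
  have haw : a ≤ w := max_le (by linarith) hw0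
  have haA : A ≤ ybar + a := by linarith [le_max_left (A - ybar) 0]
  have hbm' : ybar - b ≤ m := by linarith [le_max_left (ybar - m) 0]
  have hxw : ∀ ε > 0, ∀ᶠ t in atTop, x t ≤ ybar + w + ε := fun ε hε =>
    (hltA ε hε).mono fun t ht => by linarith
  have hab : a ≤ κ * Tbar * (ybar + w + 0) * (f1 * (b + 0)) + 0 := by
    refine le_apply_zero_of_forall_pos_le
      (g := fun ε => κ * Tbar * (ybar + w + ε) * (f1 * (b + ε)) + ε) (by fun_prop) fun ε hε => ?_
    refine max_le ?_ (by positivity)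
    rw [sub_le_iff_le_add', ← add_assoc, hTbar]
    refine hAle _ (h.eventually_card_mul_le hS hanti hybar hfzero (by positivity) (by positivity)
      hε (hxw ε hε) ?_)
    filter_upwards [hynn, h.eventually_le_total hS (hgtm ε hε)] with t ht ht'
    exact hlow _ ht _ (by positivity) (by linarith)
  have hba : b ≤ κ * Tbar * (ybar + w + 0) * (f2 * a + 0) + 0 := by
    refine le_apply_zero_of_forall_pos_le
      (g := fun ε => κ * Tbar * (ybar + w + ε) * (f2 * a + ε) + ε) (by fun_prop) fun ε hε => ?_
    refine max_le ?_ (by positivity)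
    rw [sub_le_comm, ← sub_sub, hTbar]
    refine hlem _ (h.eventually_le_card_mul hS hanti hybar hfzero (by positivity)
      hε (hxw ε hε) ?_)
    have hnear : ∀ᶠ η in nhdsWithin (0 : ℝ) (Ioi 0), f (ybar + a) - ε < f (ybar + a + η) := by
      have hc : ContinuousAt f (ybar + a) :=
        hC1.continuousOn.continuousAt (Ici_mem_nhds (by linarith))
      have hc' : Tendsto (fun η => f (ybar + a + η)) (nhds 0) (nhds (f (ybar + a))) :=
        hc.tendsto.comp (by simpa using tendsto_const_nhds.add (tendsto_id (α := ℝ) (x := nhds 0)))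
      exact (hc'.mono_left nhdsWithin_le_nhds).eventually (lt_mem_nhds (by linarith))
    obtain ⟨η, hη, hηpos⟩ := (hnear.and self_mem_nhdsWithin).exists
    have hηpos : 0 < η := hηpos
    filter_upwards [hynn, h.eventually_total_le hS (hltA η hηpos)] with t ht ht'
    have h1 : f (ybar + a + η) ≤ f (y t) :=
      hanti.antitoneOn ht (by simp; linarith) (by linarith)
    linarith [hhigh a ⟨ha0, haw⟩]
  simp only [add_zero] at hab hba
  set C := κ * Tbar * (ybar + w) with hC
  have hC0 : 0 ≤ C := by positivity
  have hcontr : C * f1 * (C * f2) < 1 := by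
    have : κ^2 * Tbar^2 * ybar * (ybar + w) * f1 * f2 / (1 - q) = C * f1 * (C * f2) := by
      rw [div_eq_iff (by linarith), hC]
      linear_combination (-(κ^2 * Tbar^2 * (ybar + w) * f1 * f2)) * hyw
    rwa [this] at hcond
  have ha_zero : a = 0 := by
    have h1 : C * f1 * b ≤ C * f1 * (C * (f2 * a)) := mul_le_mul_of_nonneg_left hba (by positivity)
    nlinarith
  have hb_zero : b = 0 := by
    rw [ha_zero] at hba
    linarith
  have hxlim : Tendsto x atTop (nhds ybar) :=
    tendsto_of_le_liminf_of_limsup_le (by rw [← hmdef]; linarith) (by rw [← hA]; linarith) hbA hbm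
  have hRlim : Tendsto R atTop (nhds (ybar / S.card)) := by
    refine (hxlim.div_const (S.card : ℝ)).congr fun t => ?_
    rw [hx]; field_simp
  have hsum : Tendsto (fun t => ∑ r ∈ S, R (t - τ r)) atTop
      (nhds (∑ _r ∈ S, ybar / S.card)) :=
    tendsto_finsetSum _ fun r _ =>
      hRlim.comp (tendsto_atTop_add_const_right _ (-τ r) tendsto_id)
  rw [Finset.sum_const, nsmul_eq_mul, mul_div_cancel₀ _ hN.ne'] at hsum
  rwa [funext hy]
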